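/- Let A be a weighted pushdown system with state set Q and stack alphabet Γ. Let n ∈ ℤ and let π = ⟨c₁, …, c_r⟩ be a valid path with weight at least n, with minimal additional stack height among all such paths from c₁ to c_r, and such that c₁ is a local minima of π. If ASH(π) ≥ (|Q|·|Γ|)², then for every m ∈ ℕ there exists a valid path π_m from c₁ to c_r such that c₁ is a local minima of π_m and w(π_m) ≥ m. -/

import Mathlib

open scoped BigOperators

namespace PDS

/-- Stack commands over a stack alphabet `Γ`. -/
inductive Com (Γ : Type) where
  | skip : Com Γ
  | pop : Com Γ
  | push (z : Γ) : Com Γ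
  deriving DecidableEq

/-- Action of a stack command on a stack string (top of stack at the head). -/
def Com.apply {Γ : Type} : Com Γ → List Γ → List Γ
  | .skip, α => α
  | .pop, α => α.tail
  | .push z, α => z :: α

/-- A transition (edge) of a pushdown system. -/
structure Edge (Q Γ : Type) where
  q1 : Q
  top : Γ
  q2 : Q
  com : Com Γ
  deriving DecidableEq

/-- A weighted pushdown system. -/
structure WPS (Q Γ : Type) where
  q0 : Q
  bot : Γ
  E : Set (Edge Q Γ)
  w : Edge Q Γ → ℤ
  no_push_bot : ∀ e ∈ E, e.com ≠ Com.push bot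
  no_pop_bot : ∀ e ∈ E, e.top = bot → e.com ≠ Com.pop

variable {Q Γ : Type}

/-- A configuration: stack string (top at head) together with a state. -/
abbrev Config (Q Γ : Type) := List Γ × Q

/-- A genuine configuration has a nonempty stack string. -/
def IsConfig (c : Config Q Γ) : Prop := c.1 ≠ []

/-- The initial configuration `(⊥, q₀)`. -/
def WPS.start (A : WPS Q Γ) : Config Q Γ := ([A.bot], A.q0)

/-- The configuration obtained by taking the edge `e` from `c`. -/
def next (c : Config Q Γ) (e : Edge Q Γ) : Config Q Γ := (e.com.apply c.1, e.q2)

/-- The edge `e` is enabled at configuration `c`. -/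
def WPS.Enabled (A : WPS Q Γ) (c : Config Q Γ) (e : Edge Q Γ) : Prop :=
  e ∈ A.E ∧ c.2 = e.q1 ∧ c.1.head? = some e.top

/-- Validity of a finite path, given by a start configuration and a list of edges. -/
def WPS.Valid (A : WPS Q Γ) : Config Q Γ → List (Edge Q Γ) → Prop
  | _, [] => True
  | c, e :: es => A.Enabled c e ∧ A.Valid (next c e) es

/-- Last configuration of the finite path `(c, es)`. -/
def endc (c : Config Q Γ) (es : List (Edge Q Γ)) : Config Q Γ := es.foldl next c

/-- The list of configurations along the finite path `(c, es)`. -/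
def trace (c : Config Q Γ) (es : List (Edge Q Γ)) : List (Config Q Γ) :=
  List.scanl next c es

/-- Total weight of a finite path. -/
def WPS.wt (A : WPS Q Γ) (es : List (Edge Q Γ)) : ℤ := (es.map A.w).sum

/-- Stack height of a configuration. -/
def height (c : Config Q Γ) : ℕ := c.1.length

/-- Stack height of a finite path: maximal stack height along it. -/
def SH (c : Config Q Γ) (es : List (Edge Q Γ)) : ℕ :=
  ((trace c es).map height).foldr max 0

/-- Additional stack height of a finite path. -/
def ASH (c : Config Q Γ) (es : List (Edge Q Γ)) : ℕ :=
  SH c es - max (height c) (height (endc c es))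

/-- The first configuration of the path is a local minima: its stack string is a
prefix (here: suffix of the list, since the top is at the head) of all stack strings
along the path. -/
def FirstMin (c : Config Q Γ) (es : List (Edge Q Γ)) : Prop :=
  ∀ c' ∈ trace c es, c.1 <:+ c'.1

/-- The edge sequence obtained from `u ++ p₁ ++ v ++ p₂ ++ x` by repeating `p₁` and
`p₂` each `j` times in place. -/
def pumped (u p₁ v p₂ x : List (Edge Q Γ)) (j : ℕ) : List (Edge Q Γ) :=
  u ++ (List.replicate j p₁).flatten ++ v ++ (List.replicate j p₂).flatten ++ x

/-- `(p₁, p₂)` is a pumpable pair of paths for the path `(c, es)`. -/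
def WPS.PumpablePair (A : WPS Q Γ) (c : Config Q Γ) (es p₁ p₂ : List (Edge Q Γ)) : Prop :=
  p₁ ≠ [] ∧ p₂ ≠ [] ∧
    ∃ u v x, es = u ++ p₁ ++ v ++ p₂ ++ x ∧
      ∀ j : ℕ, A.Valid c (pumped u p₁ v p₂ x j)

/-- The path `(c, es)` has a pumpable pair of paths. -/
def WPS.HasPumpablePair (A : WPS Q Γ) (c : Config Q Γ) (es : List (Edge Q Γ)) : Prop :=
  ∃ p₁ p₂, A.PumpablePair c es p₁ p₂

/-- `(c, es)` is a good cycle. -/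
def WPS.GoodCycle (A : WPS Q Γ) (c : Config Q Γ) (es : List (Edge Q Γ)) : Prop :=
  A.Valid c es ∧ 0 < A.wt es ∧ FirstMin c es ∧
    (endc c es).2 = c.2 ∧ (endc c es).1.head? = c.1.head?

/-- `A` has a good cycle reachable from the configuration `c`. -/
def WPS.ReachableGoodCycleFrom (A : WPS Q Γ) (c : Config Q Γ) : Prop :=
  ∃ es₀ es, A.Valid c es₀ ∧ A.GoodCycle (endc c es₀) es

/-- `A` has a good cycle (at some configuration). -/
def WPS.HasGoodCycle (A : WPS Q Γ) : Prop :=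
  ∃ c es, IsConfig c ∧ A.GoodCycle c es

/-- The finite path `(c, es)` contains a good cycle. -/
def ContainsGoodCycle (A : WPS Q Γ) (c : Config Q Γ) (es : List (Edge Q Γ)) : Prop :=
  ∃ es₁ es₂, es = es₁ ++ es₂ ∧ A.GoodCycle (endc c es₁) es₂

/-- Configurations along an infinite path given by an infinite edge sequence. -/
def confs (c : Config Q Γ) (f : ℕ → Edge Q Γ) : ℕ → Config Q Γ
  | 0 => c
  | n + 1 => next (confs c f n) (f n)

/-- Validity of the infinite path `(c, f)`. -/
def WPS.ValidInf (A : WPS Q Γ) (c : Config Q Γ) (f : ℕ → Edge Q Γ) : Prop :=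
  ∀ n, A.Enabled (confs c f n) (f n)

/-- Average weight of the prefix of length `n+1` of an infinite path. -/
noncomputable def avgPref (A : WPS Q Γ) (f : ℕ → Edge Q Γ) (n : ℕ) : ℝ :=
  (∑ i ∈ Finset.range (n + 1), (A.w (f i) : ℝ)) / (n + 1)

/-- Limit-sup of the averages along an infinite path. -/
noncomputable def LimSupAvg (A : WPS Q Γ) (f : ℕ → Edge Q Γ) : ℝ :=
  Filter.limsup (avgPref A f) Filter.atTop

/-- Limit-inf of the averages along an infinite path. -/
noncomputable def LimInfAvg (A : WPS Q Γ) (f : ℕ → Edge Q Γ) : ℝ :=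
  Filter.liminf (avgPref A f) Filter.atTop

/-- An infinite edge sequence is ultimately periodic. -/
def UltPeriodic (f : ℕ → Edge Q Γ) : Prop :=
  ∃ N p : ℕ, 0 < p ∧ ∀ n, N ≤ n → f (n + p) = f n

/-- The infinite path `(c, f)` is stack bounded. -/
def StackBounded (c : Config Q Γ) (f : ℕ → Edge Q Γ) : Prop :=
  ∃ n : ℕ, ∀ k, height (confs c f k) ≤ n

/-- Non-decreasing path: a valid path whose first configuration is a local minima. -/
def WPS.NonDec (A : WPS Q Γ) (c : Config Q Γ) (es : List (Edge Q Γ)) : Prop :=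
  A.Valid c es ∧ FirstMin c es

/-- Summary function, valued in `EReal`: `⊥` means there is no non-decreasing path
from `(⊥γ,q₁)` to `(⊥γ,q₂)`, `⊤` means `ω` (weights unbounded from above), and
otherwise the value is the maximal weight of such a path. -/
noncomputable def WPS.summary (A : WPS Q Γ) (q₁ : Q) (γ : Γ) (q₂ : Q) : EReal :=
  sSup { x : EReal | ∃ es, A.NonDec ([γ, A.bot], q₁) es ∧
    endc ([γ, A.bot], q₁) es = ([γ, A.bot], q₂) ∧ x = ((A.wt es : ℝ) : EReal) }

/-- Stack height bounded summary function: as `summary` but only over non-decreasing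
paths of additional stack height at most `d`. -/
noncomputable def WPS.summaryBdd (A : WPS Q Γ) (d : ℕ) (q₁ : Q) (γ : Γ) (q₂ : Q) : EReal :=
  sSup { x : EReal | ∃ es, A.NonDec ([γ, A.bot], q₁) es ∧
    endc ([γ, A.bot], q₁) es = ([γ, A.bot], q₂) ∧ ASH ([γ, A.bot], q₁) es ≤ d ∧
    x = ((A.wt es : ℝ) : EReal) }

/-- Edges of the summary graph `Gr(A)` together with their weights in `EReal`
(`⊤` plays the role of `ω`): skip edges weighted by the summary function and push
edges weighted by the corresponding transition weight. -/
def WPS.GrEdge (A : WPS Q Γ) (v₁ v₂ : Q × Γ) (x : EReal) : Prop :=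
  (v₁.2 = v₂.2 ∧ A.summary v₁.1 v₁.2 v₂.1 ≠ ⊥ ∧ x = A.summary v₁.1 v₁.2 v₂.1) ∨
  (∃ e ∈ A.E, e.q1 = v₁.1 ∧ e.top = v₁.2 ∧ e.q2 = v₂.1 ∧ e.com = Com.push v₂.2 ∧
    x = ((A.w e : ℝ) : EReal))

/-- The summary graph `Gr(A)` has a positive simple cycle: a simple cycle containing
an `ω`-edge or whose total weight is positive. -/
def WPS.PosSimpleCycle (A : WPS Q Γ) : Prop :=
  ∃ (k : ℕ) (v : Fin (k + 1) → Q × Γ) (x : Fin (k + 1) → EReal),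
    Function.Injective v ∧ (∀ i, A.GrEdge (v i) (v (i + 1)) (x i)) ∧
    ((∃ i, x i = ⊤) ∨ (0 : EReal) < ∑ i, x i)

/-- Weight of a finite path under the shifted weight function `w + r`. -/
def WPS.wtQ (A : WPS Q Γ) (r : ℚ) (es : List (Edge Q Γ)) : ℚ :=
  (es.map (fun e => (A.w e : ℚ) + r)).sum

/-- The shifted system `A^r` (weight function `w + r`) has a good cycle. -/
def WPS.GoodCycleShift (A : WPS Q Γ) (r : ℚ) : Prop :=
  ∃ c es, IsConfig c ∧ A.Valid c es ∧ 0 < A.wtQ r es ∧ FirstMin c es ∧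
    (endc c es).2 = c.2 ∧ (endc c es).1.head? = c.1.head?

end PDS

namespace PDS

variable {Q Γ : Type} {A : WPS Q Γ}

/-- `A.Run s c es c'`: the valid path `(c, es)` ends in `c'`, and `s` lies at the bottom of the
stack in all its configurations. -/
inductive WPS.Run (A : WPS Q Γ) (s : List Γ) :
    Config Q Γ → List (Edge Q Γ) → Config Q Γ → Prop
  | nil {c} (hs : s <:+ c.1) : A.Run s c [] c
  | cons {c e es c'} (hs : s <:+ c.1) (he : A.Enabled c e) (h : A.Run s (next c e) es c') :
      A.Run s c (e :: es) c'

theorem WPS.run_iff {s : List Γ} {c c' : Config Q Γ} {es : List (Edge Q Γ)} :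
    A.Run s c es c' ↔ A.Valid c es ∧ endc c es = c' ∧ ∀ d ∈ trace c es, s <:+ d.1 := by
  constructor
  · intro h
    induction h with
    | nil hs => simpa [WPS.Valid, endc, trace] using hs
    | cons hs he _ ih =>
      obtain ⟨h₁, h₂, h₃⟩ := ih
      refine ⟨⟨he, h₁⟩, h₂, fun d hd => ?_⟩
      rw [trace, List.scanl_cons, List.mem_cons] at hd
      rcases hd with rfl | hd
      exacts [hs, h₃ d hd]
  · induction es generalizing c with
    | nil =>
      rintro ⟨-, rfl, h⟩
      exact .nil (h c (by simp [trace]))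
    | cons e es ih =>
      rintro ⟨⟨he, hv⟩, hend, h⟩
      rw [trace, List.scanl_cons] at h
      exact .cons (h c (by simp)) he (ih ⟨hv, hend, fun d hd => h d (List.mem_cons_of_mem _ hd)⟩)

namespace WPS.Run

variable {s t : List Γ} {c c' c'' : Config Q Γ} {es es' : List (Edge Q Γ)}

theorem suffix_end (h : A.Run s c es c') : s <:+ c'.1 := by
  induction h with
  | nil hs => exact hs
  | cons _ _ _ ih => exact ih

theorem suffix_take (h : A.Run s c es c') (i : ℕ) : s <:+ (endc c (es.take i)).1 := by
  induction h generalizing i with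
  | nil hs => simpa [endc] using hs
  | cons hs _ _ ih =>
    cases i with
    | zero => simpa [endc] using hs
    | succ i => simpa [endc] using ih i

theorem append (h : A.Run s c es c') (h' : A.Run s c' es' c'') : A.Run s c (es ++ es') c'' := by
  induction h with
  | nil _ => exact h'
  | cons hs he _ ih => exact .cons hs he (ih h')

theorem mono (h : A.Run s c es c') (hts : t <:+ s) : A.Run t c es c' := by
  induction h with
  | nil hs => exact .nil (hts.trans hs)
  | cons hs he _ ih => exact .cons (hts.trans hs) he ih

/-- A run that stays above `γ :: σ` can be replayed above any stack with top `γ`. -/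
theorem replace_bottom {γ : Γ} {σ : List Γ} (h : A.Run (γ :: σ) c es c') :
    ∀ α, c.1 = α ++ γ :: σ → ∃ β, c'.1 = β ++ γ :: σ ∧
      ∀ τ, A.Run (γ :: τ) (α ++ γ :: τ, c.2) es (β ++ γ :: τ, c'.2) := by
  induction h with
  | nil hs => exact fun α hα => ⟨α, hα, fun τ => .nil (List.suffix_append _ _)⟩
  | @cons c e es c' hs he h ih =>
    intro α hα
    obtain ⟨heE, heq, hetop⟩ := he
    have henabled : ∀ τ, A.Enabled (α ++ γ :: τ, c.2) e := by
      refine fun τ => ⟨heE, heq, ?_⟩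
      rw [hα] at hetop
      cases α <;> simpa using hetop
    obtain ⟨α', hα', hnext⟩ : ∃ α', (next c e).1 = α' ++ γ :: σ ∧
        ∀ τ, next (α ++ γ :: τ, c.2) e = (α' ++ γ :: τ, (next c e).2) := by
      have hs' : γ :: σ <:+ (next c e).1 := by cases h <;> assumption
      cases hcom : e.com with
      | skip => exact ⟨α, by simp [next, hcom, Com.apply, hα], by simp [next, hcom, Com.apply]⟩
      | push z =>
        exact ⟨z :: α, by simp [next, hcom, Com.apply, hα], by simp [next, hcom, Com.apply]⟩
      | pop =>
        cases α with
        | nil =>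
          have := hs'.length_le
          simp [next, hcom, Com.apply, hα] at this
        | cons a α =>
          exact ⟨α, by simp [next, hcom, Com.apply, hα], by simp [next, hcom, Com.apply]⟩
    obtain ⟨β, hβ, hrun⟩ := ih α' hα'
    refine ⟨β, hβ, fun τ => .cons (List.suffix_append _ _) (henabled τ) ?_⟩
    rw [hnext]
    exact hrun τ

end WPS.Run

theorem WPS.wt_append (es es' : List (Edge Q Γ)) : A.wt (es ++ es') = A.wt es + A.wt es' := by
  simp [WPS.wt]

/-- Nested runs that return to the same state and top symbol can be iterated. -/
theorem WPS.exists_run_iterate {γ : Γ} {q q' : Q} {δ : List Γ} {p₁ v p₂ : List (Edge Q Γ)}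
    (h₁ : ∀ τ, A.Run (γ :: τ) (γ :: τ, q) p₁ (γ :: (δ ++ γ :: τ), q))
    (hv : ∀ τ, A.Run (γ :: τ) (γ :: τ, q) v (γ :: τ, q'))
    (h₂ : ∀ τ, A.Run (γ :: τ) (γ :: (δ ++ γ :: τ), q') p₂ (γ :: τ, q')) (j : ℕ) :
    ∃ es, (∀ τ, A.Run (γ :: τ) (γ :: τ, q) es (γ :: τ, q')) ∧
      A.wt es = A.wt v + j * (A.wt p₁ + A.wt p₂) ∧
      es.length = v.length + j * (p₁.length + p₂.length) := by
  induction j with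
  | zero => exact ⟨v, hv, by simp, by simp⟩
  | succ j ih =>
    obtain ⟨es, hrun, hw, hl⟩ := ih
    refine ⟨p₁ ++ es ++ p₂, fun τ => ?_, ?_, ?_⟩
    · exact ((h₁ τ).append ((hrun (δ ++ γ :: τ)).mono
        (List.suffix_append (γ :: δ) (γ :: τ)))).append (h₂ τ)
    · rw [wt_append, wt_append, hw]; push_cast; ring
    · simp only [List.length_append, hl]; ring

theorem WPS.Valid.enabled_getElem {c : Config Q Γ} {es : List (Edge Q Γ)} (h : A.Valid c es)
    {i : ℕ} (hi : i < es.length) : A.Enabled (endc c (es.take i)) es[i] := by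
  induction es generalizing c i with
  | nil => simp at hi
  | cons e es ih =>
    cases i with
    | zero => exact h.1
    | succ i => simpa [endc] using ih h.2 (by simpa using hi)

theorem endc_take_succ (c : Config Q Γ) {es : List (Edge Q Γ)} {i : ℕ} (hi : i < es.length) :
    endc c (es.take (i + 1)) = next (endc c (es.take i)) es[i] := by
  rw [List.take_succ_eq_append_getElem hi, endc, List.foldl_append]
  rfl

theorem height_next_le (c : Config Q Γ) (e : Edge Q Γ) : height (next c e) ≤ height c + 1 := by
  cases h : e.com <;> simp [height, next, h, Com.apply]
  omega

theorem height_le_next (c : Config Q Γ) (e : Edge Q Γ) : height c ≤ height (next c e) + 1 := by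
  cases h : e.com <;> simp [height, next, h, Com.apply]
  all_goals omega

theorem height_take_succ_le (c : Config Q Γ) (es : List (Edge Q Γ)) (i : ℕ) :
    height (endc c (es.take (i + 1))) ≤ height (endc c (es.take i)) + 1 := by
  by_cases hi : i < es.length
  · rw [endc_take_succ c hi]
    exact height_next_le _ _
  · rw [List.take_of_length_le (by omega), List.take_of_length_le (by omega)]
    omega

theorem height_take_le_succ (c : Config Q Γ) (es : List (Edge Q Γ)) (i : ℕ) :
    height (endc c (es.take i)) ≤ height (endc c (es.take (i + 1))) + 1 := by
  by_cases hi : i < es.length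
  · rw [endc_take_succ c hi]
    exact height_le_next _ _
  · rw [List.take_of_length_le (by omega), List.take_of_length_le (by omega)]
    omega

theorem suffix_next {s : List Γ} {c : Config Q Γ} {e : Edge Q Γ} (hs : s <:+ c.1)
    (h : s.length ≤ height (next c e)) : s <:+ (next c e).1 := by
  cases hcom : e.com with
  | skip => simpa [next, hcom, Com.apply] using hs
  | push z => simpa [next, hcom, Com.apply] using hs.trans (List.suffix_cons z c.1)
  | pop =>
    simp only [next, hcom, Com.apply, height] at h ⊢
    exact List.suffix_of_suffix_length_le hs (List.tail_suffix _) h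

theorem exists_height_eq_SH (c : Config Q Γ) (es : List (Edge Q Γ)) :
    ∃ i ≤ es.length, height (endc c (es.take i)) = SH c es := by
  induction es generalizing c with
  | nil => exact ⟨0, by simp [SH, trace, endc]⟩
  | cons e es ih =>
    have hSH : SH c (e :: es) = max (height c) (SH (next c e) es) := by
      simp [SH, trace, List.scanl_cons]
    obtain ⟨i, hi, h⟩ := ih (next c e)
    rcases le_total (height c) (SH (next c e) es) with hle | hle
    · exact ⟨i + 1, by simpa using hi, by rw [hSH, max_eq_right hle, ← h]; simp [endc]⟩
    · exact ⟨0, by simp, by rw [hSH, max_eq_left hle]; simp [endc]⟩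

/-- The part of a valid path between two positions, as a run above a given stack. -/
theorem WPS.Valid.run_slice {s : List Γ} {c : Config Q Γ} {es : List (Edge Q Γ)}
    (hv : A.Valid c es) {i j : ℕ} (hij : i ≤ j) (hj : j ≤ es.length)
    (hs : s <:+ (endc c (es.take i)).1)
    (hh : ∀ k, i ≤ k → k ≤ j → s.length ≤ height (endc c (es.take k))) :
    A.Run s (endc c (es.take i)) ((es.take j).drop i) (endc c (es.take j)) := by
  induction j, hij using Nat.le_induction with
  | base =>
    rw [List.drop_eq_nil_of_le (by simp)]
    exact .nil hs
  | succ j hij ih =>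
    have hrun := ih (by omega) fun k hk hk' => hh k hk (by omega)
    rw [endc_take_succ c hj, List.take_succ_eq_append_getElem hj,
      List.drop_append_of_le_length (by simp; omega)]
    refine hrun.append (.cons hrun.suffix_end (hv.enabled_getElem hj) (.nil ?_))
    refine suffix_next hrun.suffix_end ?_
    rw [← endc_take_succ c hj]
    exact hh _ (by omega) le_rfl

/-- Discrete intermediate value theorem: the last visit of level `h` before `p`. -/
theorem exists_last_visit {f : ℕ → ℕ} (hf : ∀ i, f (i + 1) ≤ f i + 1) {h p : ℕ}
    (h0 : f 0 ≤ h) (hp : h ≤ f p) :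
    ∃ a ≤ p, f a = h ∧ ∀ i, a ≤ i → i ≤ p → h ≤ f i := by
  induction p with
  | zero => exact ⟨0, le_rfl, by omega, fun i _ hi => by rwa [Nat.le_zero.1 hi]⟩
  | succ p ih =>
    rcases hp.eq_or_lt with heq | hlt
    · refine ⟨p + 1, le_rfl, heq.symm, fun i hi hi' => ?_⟩
      obtain rfl : i = p + 1 := by omega
      exact hp
    · obtain ⟨a, ha, hfa, hall⟩ := ih (by have := hf p; omega)
      refine ⟨a, by omega, hfa, fun i hi hi' => ?_⟩
      rcases hi'.eq_or_lt with rfl | hi'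
      exacts [hp, hall i hi (by omega)]

/-- The first visit of level `h` after `p`. -/
theorem exists_first_visit {f : ℕ → ℕ} (hf : ∀ i, f i ≤ f (i + 1) + 1) {h p L : ℕ}
    (hpL : p ≤ L) (hL : f L ≤ h) (hp : h ≤ f p) :
    ∃ b, p ≤ b ∧ b ≤ L ∧ f b = h ∧ ∀ i, p ≤ i → i ≤ b → h ≤ f i := by
  obtain ⟨a, ha, hfa, hall⟩ := exists_last_visit (f := fun i => f (L - i)) (h := h) (p := L - p)
    (fun i => by
      rcases lt_or_ge i L with hi | hi
      · have := hf (L - (i + 1))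
        rwa [show L - (i + 1) + 1 = L - i by omega] at this
      · simp [show L - (i + 1) = L - i by omega])
    (by simpa using hL) (by simpa [show L - (L - p) = p by omega] using hp)
  refine ⟨L - a, by omega, by omega, hfa, fun i hi hi' => ?_⟩
  simpa [show L - (L - i) = i by omega] using hall (L - i) (by omega) (by omega)

theorem take_append_drop_take {α : Type*} (l : List α) {i j : ℕ} (hij : i ≤ j) :
    l.take i ++ (l.take j).drop i = l.take j := by
  conv_rhs => rw [← List.take_append_drop i (l.take j), List.take_take, min_eq_left hij]

theorem WPS.wt_slice (es : List (Edge Q Γ)) {i j : ℕ} (hij : i ≤ j) :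
    A.wt ((es.take j).drop i) = A.wt (es.take j) - A.wt (es.take i) := by
  rw [← take_append_drop_take es hij, wt_append, take_append_drop_take es hij]
  ring

/-- A non-decreasing run that rises high above its last configuration can be pumped, both up
and down. -/
theorem WPS.Run.exists_pump [Fintype Q] [Fintype Γ] {c c' : Config Q Γ} {es : List (Edge Q Γ)}
    (hc : IsConfig c) (hrun : A.Run c.1 c es c')
    (hSH : (Fintype.card Q * Fintype.card Γ) ^ 2 + height c' ≤ SH c es) :
    ∃ (w : ℤ) (d : ℕ), 0 < d ∧ ∀ j : ℕ, ∃ es', A.Run c.1 c es' c' ∧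
      A.wt es' + w = A.wt es + j * w ∧ es'.length + d = es.length + j * d := by
  obtain ⟨hv, hend, -⟩ := run_iff.1 hrun
  obtain ⟨p, hpL, hp⟩ := exists_height_eq_SH c es
  have hcle : ∀ i, height c ≤ height (endc c (es.take i)) :=
    fun i => (hrun.suffix_take i).length_le
  have hcc' : height c ≤ height c' := hrun.suffix_end.length_le
  have hcpos : 0 < height c := List.length_pos_of_ne_nil hc
  have hendL : endc c (es.take es.length) = c' := by rw [List.take_length, hend]
  set N := (Fintype.card Q * Fintype.card Γ) ^ 2 with hN
  have hlevel : ∀ k : Fin (N + 1), ∃ (a b : ℕ) (γ : Γ) (σ : List Γ) (q q' : Q),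
      a ≤ p ∧ p ≤ b ∧ b ≤ es.length ∧ σ.length + 1 = height c' + k ∧
      endc c (es.take a) = (γ :: σ, q) ∧ endc c (es.take b) = (γ :: σ, q') ∧
      ∀ i, a ≤ i → i ≤ b → height c' + k ≤ height (endc c (es.take i)) := by
    intro k
    have hk := k.2
    have hkp : height c' + k ≤ height (endc c (es.take p)) := by omega
    obtain ⟨a, hap, ha, ha'⟩ := exists_last_visit
      (f := fun i => height (endc c (es.take i))) (height_take_succ_le c es)
      (h := height c' + k) (hcc'.trans (Nat.le_add_right _ _)) hkp
    obtain ⟨b, hpb, hbL, hb, hb'⟩ := exists_first_visit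
      (f := fun i => height (endc c (es.take i))) (height_take_le_succ c es)
      hpL (by rw [hendL]; omega) hkp
    have hab : ∀ i, a ≤ i → i ≤ b → height c' + k ≤ height (endc c (es.take i)) := by
      intro i hi hi'
      rcases le_total i p with h | h
      exacts [ha' i hi h, hb' i h hi']
    have hsuf := (hv.run_slice (s := (endc c (es.take a)).1) (hap.trans hpb) hbL
      List.suffix_rfl (fun i hi hi' => ha.trans_le (hab i hi hi'))).suffix_end
    have heq := hsuf.eq_of_length (ha.trans hb.symm)
    obtain ⟨γ, σ, hγ⟩ : ∃ γ σ, (endc c (es.take a)).1 = γ :: σ :=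
      List.exists_cons_of_ne_nil (List.ne_nil_of_length_pos (by
        change 0 < height _
        omega))
    refine ⟨a, b, γ, σ, (endc c (es.take a)).2, (endc c (es.take b)).2, hap, hpb, hbL, ?_,
      Prod.ext hγ rfl, Prod.ext (heq ▸ hγ) rfl, hab⟩
    rw [← ha, height, hγ, List.length_cons]
  choose a b γ σ q q' hap hpb hbL hlen hca hcb hab using hlevel
  obtain ⟨k, l, hkl, hkey⟩ : ∃ k l, k < l ∧ (q k, γ k, q' k) = (q l, γ l, q' l) := by
    obtain ⟨k, l, hne, heq⟩ := Fintype.exists_ne_map_eq_of_card_lt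
      (fun k => (q k, γ k, q' k)) (by
        simp only [Fintype.card_prod, Fintype.card_fin, hN]
        have : Fintype.card Γ ≤ Fintype.card Γ ^ 2 := Nat.le_self_pow (by norm_num) _
        nlinarith [Nat.mul_le_mul_left (Fintype.card Q ^ 2) this])
    rcases hne.lt_or_gt with h | h
    exacts [⟨k, l, h, heq⟩, ⟨l, k, h, heq.symm⟩]
  simp only [Prod.mk.injEq] at hkey
  obtain ⟨hq, hγ, hq'⟩ := hkey
  have hkl' : (k : ℕ) < l := hkl
  have hheight : ∀ r : Q, height (γ k :: σ k, r) = height c' + k := fun _ => hlen k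
  have hakl : a k < a l := by
    by_contra! h
    have h₁ := hab l (a k) h ((hap k).trans (hpb l))
    rw [hca k, hheight] at h₁
    omega
  have hbkl : b l < b k := by
    by_contra! h
    have h₁ := hab l (b k) ((hap l).trans (hpb k)) h
    rw [hcb k, hheight] at h₁
    omega
  have habl : a l ≤ b l := (hap l).trans (hpb l)
  have hlow : ∀ i, a k ≤ i → i ≤ b k → (γ k :: σ k).length ≤ height (endc c (es.take i)) :=
    fun i hi hi' => by rw [List.length_cons, hlen k]; exact hab k i hi hi'
  have hu := hv.run_slice (s := c.1) (Nat.zero_le (a k)) (by have := hbL k; omega)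
    (hrun.suffix_take 0) (fun i _ _ => hcle i)
  have h₁ := hv.run_slice (s := γ k :: σ k) hakl.le (by have := hbL k; omega)
    (by rw [hca k]) (fun i hi hi' => hlow i hi (by omega))
  have h_mid := hv.run_slice (s := γ l :: σ l) habl (hbL l) (by rw [hca l])
    (fun i hi hi' => by rw [List.length_cons, hlen l]; exact hab l i hi hi')
  have h₂ := hv.run_slice (s := γ k :: σ k) hbkl.le (hbL k)
    (hv.run_slice (s := γ k :: σ k) (i := a k) (j := b l) (by omega) (hbL l)
      (by rw [hca k]) (fun i hi hi' => hlow i hi (by omega))).suffix_end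
    (fun i hi hi' => hlow i (by omega) hi')
  have hx := hv.run_slice (s := c.1) (hbL k) le_rfl
    (hrun.suffix_take (b k)) (fun i _ _ => hcle i)
  rw [hca k, hca l, ← hγ, ← hq] at h₁
  rw [hca l, hcb l, ← hγ, ← hq, ← hq'] at h_mid
  rw [hcb k, hcb l, ← hγ, ← hq'] at h₂
  rw [hca k] at hu
  rw [hcb k, hendL] at hx
  obtain ⟨ε, hε, hR₁⟩ := h₁.replace_bottom [] rfl
  obtain ⟨δ, rfl⟩ : ∃ δ, ε = γ k :: δ := by
    cases ε with
    | nil =>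
      have h₃ := congrArg List.length hε
      have := hlen k
      have := hlen l
      simp at h₃
      omega
    | cons z δ => exact ⟨δ, by simp_all⟩
  obtain ⟨ζ, hζ, hR_mid⟩ := h_mid.replace_bottom [] rfl
  obtain rfl : ζ = [] := by simpa using hζ
  obtain ⟨η, hη, hR₂⟩ := h₂.replace_bottom (γ k :: δ) hε
  obtain rfl : η = [] := by simpa using hη
  have hsc : c.1 <:+ γ k :: σ k := hu.suffix_end
  refine ⟨A.wt ((es.take (a l)).drop (a k)) + A.wt ((es.take (b k)).drop (b l)),
    ((es.take (a l)).drop (a k)).length + ((es.take (b k)).drop (b l)).length, ?_, fun j => ?_⟩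
  · have := hbL l
    simp only [List.length_drop, List.length_take]
    omega
  · obtain ⟨m, hm, hmw, hml⟩ := exists_run_iterate hR₁ hR_mid hR₂ j
    refine ⟨_, (hu.append ((hm (σ k)).mono hsc)).append hx, ?_, ?_⟩
    · rw [wt_append, wt_append, hmw, wt_slice es hakl.le, wt_slice es habl, wt_slice es hbkl.le,
        wt_slice es (hbL k), wt_slice es (Nat.zero_le _), List.take_length]
      simp only [List.take_zero, WPS.wt, List.map_nil, List.sum_nil]
      ring
    · rw [List.length_append, List.length_append, hml]
      have := hbL k
      have := hbL l
      simp only [List.length_drop, List.length_take]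
      rw [min_eq_left (by omega), min_eq_left (by omega), min_eq_left (by omega),
        min_eq_left (by omega), min_self]
      generalize j * _ = J
      omega

end PDS

open PDS in
/-- if a path from `c₁` to `c_r` of weight at least `n` has minimal
additional stack height among all such paths, `c₁` is a local minima of it, and its
additional stack height is at least `(|Q|·|Γ|)²`, then paths from `c₁` to `c_r`
(with `c₁` a local minima) of arbitrarily large weight exist. -/
theorem max_depth_big_then_weight_unbounded
    {Q Γ : Type} [Fintype Q] [Fintype Γ]
    (A : WPS Q Γ) (n : ℤ) (c₁ : Config Q Γ) (es : List (Edge Q Γ))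
    (hc₁ : IsConfig c₁)
    (hvalid : A.Valid c₁ es) (hwt : n ≤ A.wt es) (hmin₁ : FirstMin c₁ es)
    (hminASH : ∀ es', A.Valid c₁ es' → endc c₁ es' = endc c₁ es → n ≤ A.wt es' →
      ASH c₁ es ≤ ASH c₁ es')
    (hASH : (Fintype.card Q * Fintype.card Γ) ^ 2 ≤ ASH c₁ es) :
    ∀ m : ℕ, ∃ es_m, A.Valid c₁ es_m ∧ endc c₁ es_m = endc c₁ es ∧
      FirstMin c₁ es_m ∧ (m : ℤ) ≤ A.wt es_m := by
  intro m
  have hrun : A.Run c₁.1 c₁ es (endc c₁ es) := WPS.run_iff.2 ⟨hvalid, rfl, hmin₁⟩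
  set cr := endc c₁ es
  obtain ⟨es', ⟨hrun', hwt'⟩, hshort⟩ := exists_minimalFor_of_wellFoundedLT
    (fun es' => A.Run c₁.1 c₁ es' cr ∧ n ≤ A.wt es') List.length ⟨es, hrun, hwt⟩
  obtain ⟨hv', hend', -⟩ := WPS.run_iff.1 hrun'
  have : Nonempty Q := ⟨c₁.2⟩
  have : Nonempty Γ := ⟨c₁.1.head hc₁⟩
  have hpos : 0 < (Fintype.card Q * Fintype.card Γ) ^ 2 :=
    pow_pos (Nat.mul_pos Fintype.card_pos Fintype.card_pos) 2
  have hASH' := hASH.trans (hminASH es' hv' hend' hwt')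
  rw [ASH, hend'] at hASH'
  obtain ⟨w, d, hd, hpump⟩ := hrun'.exists_pump hc₁ (by omega)
  have hw : 0 < w := by
    by_contra! hw
    obtain ⟨es₀, hrun₀, hwt₀, hlen₀⟩ := hpump 0
    simp only [Nat.cast_zero, zero_mul, add_zero] at hwt₀ hlen₀
    have := hshort (j := es₀) ⟨hrun₀, by omega⟩ (by omega)
    omega
  obtain ⟨esm, hrunm, hwtm, -⟩ := hpump (m + n.natAbs + 1)
  obtain ⟨hvm, hendm, hminm⟩ := WPS.run_iff.1 hrunm
  refine ⟨esm, hvm, hendm, hminm, ?_⟩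
  have hn : 0 ≤ n + n.natAbs := by omega
  push_cast at hwtm hn
  nlinarith [mul_nonneg (by positivity : (0 : ℤ) ≤ m + |n|) (by omega : (0 : ℤ) ≤ w - 1)]
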